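/- Suppose n > m(1 − 1/k) and 0 < p ≤ 1 − m/n. If conditions (1.4) and (1.5) hold and lim_{r → 0+} f(r)/r^μ = ∞ for some real number μ < p/(1 − m/n), then every global weak solution u of the problem ∂_t^k u − Σ_{|α|=m} ∂^α a_α(x,t,u) ≥ f(|u|) in ℝ^{n+1}_+ with initial data ∂_t^i u(·,0) = u_i (0 ≤ i ≤ k−1) is trivial, i.e. u = 0 almost everywhere in ℝ^{n+1}_+. -/

import Mathlib

open MeasureTheory Real Set Filter

noncomputable section

/-- The spatial domain `ℝⁿ`. -/
abbrev Spc (n : ℕ) := EuclideanSpace ℝ (Fin n)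

/-- The open ball `B_r` in `ℝⁿ` of radius `r` centered at `0`. -/
def ball0 (n : ℕ) (r : ℝ) : Set (Spc n) := Metric.ball 0 r

/-- The cylinder `Q_r^κ = B_r × (0, r^κ)`. -/
def cyl (n : ℕ) (r κ : ℝ) : Set (Spc n × ℝ) := ball0 n r ×ˢ Ioo 0 (r ^ κ)

/-- The half-space `ℝ^{n+1}_+ = ℝⁿ × (0, ∞)`. -/
def halfSp (n : ℕ) : Set (Spc n × ℝ) := {z | 0 < z.2}

/-- The (finite) set of multi-indices `α` with `|α| = m`. -/
def mIdx (n m : ℕ) : Finset (Fin n → ℕ) :=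
  (Fintype.piFinset fun _ : Fin n => Finset.range (m + 1)).filter fun α => ∑ i, α i = m

/-- Spatial partial derivative `∂/∂x_i`. -/
def spDeriv (n : ℕ) (i : Fin n) (φ : Spc n × ℝ → ℝ) : Spc n × ℝ → ℝ :=
  fun z => deriv (fun s : ℝ => φ (z.1 + s • EuclideanSpace.single i (1 : ℝ), z.2)) 0

/-- Time derivative `∂/∂t`. -/
def tDeriv (n : ℕ) (φ : Spc n × ℝ → ℝ) : Spc n × ℝ → ℝ :=
  fun z => deriv (fun s : ℝ => φ (z.1, s)) z.2

/-- Multi-index spatial derivative `∂^α`. -/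
def mDeriv (n : ℕ) (α : Fin n → ℕ) (φ : Spc n × ℝ → ℝ) : Spc n × ℝ → ℝ :=
  (List.finRange n).foldr (fun i ψ => (spDeriv n i)^[α i] ψ) φ

/-- Caratheodory conditions and the growth bound `|a_α(x,t,ζ)| ≤ A |ζ|^p` for the
coefficients of the operator `L`. -/
def GoodCoeffs (n m : ℕ) (A p : ℝ) (a : (Fin n → ℕ) → Spc n × ℝ → ℝ → ℝ) : Prop :=
  ∀ α ∈ mIdx n m,
    (∀ ζ : ℝ, Measurable fun z => a α z ζ) ∧
    (∀ᵐ z ∂(volume.restrict (halfSp n)), Continuous fun ζ => a α z ζ) ∧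
    (∀ᵐ z ∂(volume.restrict (halfSp n)), ∀ ζ : ℝ, |a α z ζ| ≤ A * |ζ| ^ p)

/-- The standing conditions on `f`: `ζ ↦ f ζ` and `ζ ↦ f (ζ^{1/p})` are nondecreasing
and convex on `[0,∞)`, and `f` is positive on `(0,∞)`. -/
def GoodF (p : ℝ) (f : ℝ → ℝ) : Prop :=
  MonotoneOn f (Ici 0) ∧ ConvexOn ℝ (Ici 0) f ∧
  MonotoneOn (fun ζ => f (ζ ^ (1 / p))) (Ici 0) ∧
  ConvexOn ℝ (Ici 0) (fun ζ => f (ζ ^ (1 / p))) ∧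
  ∀ ζ : ℝ, 0 < ζ → 0 < f ζ

/-- Condition (1.4): `∫_1^∞ ζ^{1/k - 1} f(ζ)^{-1/k} dζ < ∞`. -/
def Cond14 (k : ℕ) (f : ℝ → ℝ) : Prop :=
  IntegrableOn (fun ζ : ℝ => ζ ^ ((k : ℝ)⁻¹ - 1) / f ζ ^ ((k : ℝ)⁻¹)) (Ioi 1)

/-- Condition (1.5): `∫_1^∞ ζ^{p/m - 1} f(ζ)^{-1/m} dζ < ∞`. -/
def Cond15 (m : ℕ) (p : ℝ) (f : ℝ → ℝ) : Prop :=
  IntegrableOn (fun ζ : ℝ => ζ ^ (p / (m : ℝ) - 1) / f ζ ^ ((m : ℝ)⁻¹)) (Ioi 1)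

/-- `v ∈ L^1_loc(ℝⁿ)`. -/
def L1locInit (n : ℕ) (v : Spc n → ℝ) : Prop :=
  ∀ r : ℝ, 0 < r → IntegrableOn v (ball0 n r)

/-- `u` is a global weak solution of
`∂_t^k u - Σ_{|α| = m} ∂^α a_α(x,t,u) ≥ f(|u|)` in `ℝ^{n+1}_+`, with initial data
`∂_t^i u(·,0) = u0 i` for `0 ≤ i ≤ k-1`. -/
def IsGlobalWeakSol (n k m : ℕ) (p : ℝ) (a : (Fin n → ℕ) → Spc n × ℝ → ℝ → ℝ)
    (f : ℝ → ℝ) (u0 : ℕ → Spc n → ℝ) (u : Spc n × ℝ → ℝ) : Prop :=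
  (∀ r : ℝ, 0 < r → IntegrableOn u (cyl n r 1)) ∧
  (∀ r : ℝ, 0 < r → IntegrableOn (fun z => |u z| ^ p) (cyl n r 1)) ∧
  (∀ r : ℝ, 0 < r → IntegrableOn (fun z => f |u z|) (cyl n r 1)) ∧
  ∀ φ : Spc n × ℝ → ℝ, ContDiff ℝ (⊤ : ℕ∞) φ → HasCompactSupport φ →
    (∀ z, 0 ≤ φ z) →
    (∫ z in halfSp n, (-1 : ℝ) ^ k * u z * (tDeriv n)^[k] φ z)
      - (∫ z in halfSp n, ∑ α ∈ mIdx n m, (-1 : ℝ) ^ m * a α z (u z) * mDeriv n α φ z)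
    ≥ (∫ x : Spc n, ∑ i ∈ Finset.range k,
          (-1 : ℝ) ^ i * u0 (k - 1 - i) x * (tDeriv n)^[i] φ (x, 0))
      + ∫ z in halfSp n, f |u z| * φ z

/-- `u = 0` almost everywhere in `ℝ^{n+1}_+`. -/
def TrivialSol (n : ℕ) (u : Spc n × ℝ → ℝ) : Prop :=
  ∀ᵐ z ∂(volume.restrict (halfSp n)), u z = 0

/-! ### One-dimensional cutoff functions -/

/-- A smooth cutoff equal to `1` on `[-r, r]` and to `0` outside `[-(r + h), r + h]`. -/
def cutoff (r h s : ℝ) : ℝ :=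
  smoothTransition ((r + h) / h + (-h⁻¹) * s) + smoothTransition ((r + h) / h + h⁻¹ * s) - 1

lemma cutoff_contDiff (r h : ℝ) : ContDiff ℝ (⊤ : ℕ∞) (cutoff r h) := by
  unfold cutoff
  refine ContDiff.sub (ContDiff.add ?_ ?_) contDiff_const <;>
  exact smoothTransition.contDiff.comp (by fun_prop)

lemma cutoff_nonneg {r h : ℝ} (hr : 0 < r) (hh : 0 < h) (s : ℝ) : 0 ≤ cutoff r h s := by
  have key : ∀ y : ℝ, 0 ≤ y → 1 ≤ (r + h) / h + h⁻¹ * y := fun y hy => by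
    rw [add_div, div_self hh.ne']
    have : 0 ≤ r / h := by positivity
    have : 0 ≤ h⁻¹ * y := by positivity
    linarith
  unfold cutoff
  rcases le_total 0 s with hs | hs
  · rw [smoothTransition.one_of_one_le (key s hs)]
    linarith [smoothTransition.nonneg ((r + h) / h + (-h⁻¹) * s)]
  · have := key (-s) (by linarith)
    rw [mul_neg, ← neg_mul] at this
    rw [smoothTransition.one_of_one_le this]
    linarith [smoothTransition.nonneg ((r + h) / h + h⁻¹ * s)]

lemma cutoff_eq_one {r h s : ℝ} (hh : 0 < h) (hs : |s| ≤ r) : cutoff r h s = 1 := by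
  obtain ⟨h1, h2⟩ := abs_le.1 hs
  unfold cutoff
  rw [smoothTransition.one_of_one_le, smoothTransition.one_of_one_le]
  · norm_num
  all_goals
    rw [← sub_nonneg]
    field_simp
    linarith

lemma cutoff_eq_zero {r h s : ℝ} (hr : 0 < r) (hh : 0 < h) (hs : r + h < |s|) :
    cutoff r h s = 0 := by
  have key : ∀ y : ℝ, r + h < y → smoothTransition ((r + h) / h + (-h⁻¹) * y) = 0 ∧
      smoothTransition ((r + h) / h + h⁻¹ * y) = 1 := fun y hy => by
    constructor
    · apply smoothTransition.zero_of_nonpos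
      rw [← sub_nonneg]
      field_simp
      linarith
    · apply smoothTransition.one_of_one_le
      rw [← sub_nonneg]
      field_simp
      linarith
  unfold cutoff
  rcases lt_abs.1 hs with h1 | h1
  · rw [(key s h1).1, (key s h1).2]; norm_num
  · have h2 := key (-s) h1
    rw [mul_neg, ← neg_mul, neg_neg, mul_neg, ← neg_mul] at h2
    rw [h2.1, h2.2]; norm_num

lemma iteratedDeriv_cutoff_eq_zero {r h s : ℝ} (hr : 0 < r) (hh : 0 < h) (hs : r + h < |s|)
    (j : ℕ) : iteratedDeriv j (cutoff r h) s = 0 := by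
  have : cutoff r h =ᶠ[nhds s] fun _ => 0 := by
    filter_upwards [(isOpen_lt continuous_const continuous_abs).mem_nhds hs] with y hy
    exact cutoff_eq_zero hr hh hy
  rw [this.iteratedDeriv_eq]
  simp

lemma iteratedDeriv_cutoff_zero {r h : ℝ} (hr : 0 < r) (hh : 0 < h)
    {j : ℕ} (hj : j ≠ 0) : iteratedDeriv j (cutoff r h) 0 = 0 := by
  have : cutoff r h =ᶠ[nhds 0] fun _ => 1 := by
    filter_upwards [(isOpen_lt continuous_abs continuous_const).mem_nhds
      (show |(0 : ℝ)| < r by simpa using hr)] with y hy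
    exact cutoff_eq_one hh (le_of_lt hy)
  rw [this.iteratedDeriv_eq]
  simp [iteratedDeriv_const, hj]

lemma exists_bound_iteratedDeriv_smoothTransition (j : ℕ) :
    ∃ D : ℝ, ∀ s, |iteratedDeriv j smoothTransition s| ≤ D := by
  have hc : Continuous (iteratedDeriv j smoothTransition) :=
    (smoothTransition.contDiff (n := j)).continuous_iteratedDeriv j le_rfl
  obtain ⟨D, hD⟩ := (isCompact_Icc (a := (0 : ℝ)) (b := 1)).exists_bound_of_continuousOn
    hc.continuousOn
  refine ⟨max D 1, fun s => ?_⟩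
  by_cases hs : s ∈ Icc (0 : ℝ) 1
  · exact (hD s hs).trans (le_max_left _ _)
  refine le_trans ?_ (le_max_right _ _)
  have hs' : s < 0 ∨ 1 < s := by
    by_contra! hcon
    exact hs ⟨hcon.1, hcon.2⟩
  rcases hs' with hs | hs
  · have : smoothTransition =ᶠ[nhds s] fun _ => 0 := by
      filter_upwards [Iio_mem_nhds hs] with y hy
      exact smoothTransition.zero_of_nonpos (le_of_lt hy)
    rw [this.iteratedDeriv_eq]
    simp
  · have : smoothTransition =ᶠ[nhds s] fun _ => 1 := by
      filter_upwards [Ioi_mem_nhds hs] with y hy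
      exact smoothTransition.one_of_one_le (le_of_lt hy)
    rw [this.iteratedDeriv_eq, iteratedDeriv_const]
    split_ifs <;> simp

lemma iteratedDeriv_smoothTransition_comp (j : ℕ) (a c s : ℝ) :
    iteratedDeriv j (fun y => smoothTransition (a + c * y)) s =
      c ^ j * iteratedDeriv j smoothTransition (a + c * s) := by
  have hcd : ContDiff ℝ j fun y => smoothTransition (a + y) :=
    smoothTransition.contDiff.comp (by fun_prop)
  rw [iteratedDeriv_comp_const_mul (f := fun y => smoothTransition (a + y)) hcd,
    iteratedDeriv_comp_const_add]

lemma exists_bound_iteratedDeriv_cutoff_single (j : ℕ) :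
    ∃ D : ℝ, ∀ r h : ℝ, 0 < r → 0 < h → ∀ s,
      |iteratedDeriv j (cutoff r h) s| ≤ D * (h⁻¹) ^ j := by
  obtain ⟨D, hD⟩ := exists_bound_iteratedDeriv_smoothTransition j
  refine ⟨D + D + 1, fun r h hr hh s => ?_⟩
  have hD0 : 0 ≤ D := (abs_nonneg _).trans (hD 0)
  have hcd : ∀ c : ℝ, ContDiff ℝ j fun y => smoothTransition ((r + h) / h + c * y) :=
    fun c => smoothTransition.contDiff.comp (by fun_prop)
  have hterm : ∀ c : ℝ, |c| = h⁻¹ →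
      |iteratedDeriv j (fun y => smoothTransition ((r + h) / h + c * y)) s|
        ≤ D * (h⁻¹) ^ j := fun c hc => by
    rw [iteratedDeriv_smoothTransition_comp, abs_mul, abs_pow, hc, mul_comm]
    gcongr
    exact hD _
  have hi : 0 < h⁻¹ := inv_pos.2 hh
  have h1 := hterm (-h⁻¹) (by rw [abs_neg, abs_of_pos hi])
  have h2 := hterm h⁻¹ (abs_of_pos hi)
  have h3 : |iteratedDeriv j (fun _ : ℝ => (1 : ℝ)) s| ≤ (h⁻¹) ^ j := by
    rw [iteratedDeriv_const]
    split_ifs with hj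
    · simp [hj]
    · rw [abs_zero]
      positivity
  unfold cutoff
  rw [iteratedDeriv_fun_sub ((hcd _).add (hcd _)).contDiffAt contDiffAt_const,
    iteratedDeriv_fun_add (hcd _).contDiffAt (hcd _).contDiffAt]
  refine (abs_sub _ _).trans ((add_le_add (abs_add_le _ _) le_rfl).trans ?_)
  linarith

lemma exists_bound_iteratedDeriv_cutoff (N : ℕ) :
    ∃ D : ℝ, 1 ≤ D ∧ ∀ r h : ℝ, 0 < r → 0 < h → ∀ j ≤ N, ∀ s,
      |iteratedDeriv j (cutoff r h) s| ≤ D * (h⁻¹) ^ j := by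
  choose D hD using exists_bound_iteratedDeriv_cutoff_single
  refine ⟨1 + ∑ j ∈ Finset.range (N + 1), |D j|,
    le_add_of_nonneg_right (Finset.sum_nonneg fun _ _ => abs_nonneg _),
    fun r h hr hh j hj s => (hD j r h hr hh s).trans ?_⟩
  gcongr
  have := Finset.single_le_sum (f := fun j => |D j|) (fun i _ => abs_nonneg _)
    (Finset.mem_range.2 (Nat.lt_succ_of_le hj))
  linarith [le_abs_self (D j)]

/-! ### Product test functions and their derivatives -/

/-- The tensor product `T(t) ∏ g_i(x_i)`. -/
def tensorFun (n : ℕ) (T : ℝ → ℝ) (g : Fin n → ℝ → ℝ) (z : Spc n × ℝ) : ℝ :=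
  T z.2 * ∏ j, g j (z.1 j)

lemma tDeriv_tensorFun (n : ℕ) (T : ℝ → ℝ) (g : Fin n → ℝ → ℝ) :
    tDeriv n (tensorFun n T g) = tensorFun n (deriv T) g := by
  funext z
  simp only [tDeriv, tensorFun]
  exact deriv_mul_const_field _

lemma tDeriv_iterate_tensorFun (n : ℕ) (g : Fin n → ℝ → ℝ) (j : ℕ) (T : ℝ → ℝ) :
    (tDeriv n)^[j] (tensorFun n T g) = tensorFun n (iteratedDeriv j T) g := by
  induction j generalizing T with
  | zero => simp
  | succ j ih => rw [Function.iterate_succ_apply, tDeriv_tensorFun, ih, iteratedDeriv_succ']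

lemma spDeriv_tensorFun (n : ℕ) (i : Fin n) (T : ℝ → ℝ) (g : Fin n → ℝ → ℝ) :
    spDeriv n i (tensorFun n T g) = tensorFun n T (Function.update g i (deriv (g i))) := by
  funext z
  have h1 : ∀ s : ℝ, tensorFun n T g (z.1 + s • EuclideanSpace.single i (1 : ℝ), z.2) =
      (T z.2 * ∏ j ∈ Finset.univ.erase i, g j (z.1 j)) * g i (z.1 i + s) := fun s => by
    rw [tensorFun, ← Finset.mul_prod_erase _ _ (Finset.mem_univ i)]
    rw [Finset.prod_congr rfl (g := fun j => g j (z.1 j)) fun j hj => by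
      simp [Finset.ne_of_mem_erase hj]]
    simp
    ring
  have h2 : tensorFun n T (Function.update g i (deriv (g i))) z =
      (T z.2 * ∏ j ∈ Finset.univ.erase i, g j (z.1 j)) * deriv (g i) (z.1 i) := by
    rw [tensorFun, ← Finset.mul_prod_erase _ _ (Finset.mem_univ i)]
    rw [Finset.prod_congr rfl (g := fun j => g j (z.1 j)) fun j hj => by
      simp [Finset.ne_of_mem_erase hj]]
    simp
    ring
  rw [h2, spDeriv]
  simp only [h1]
  rw [deriv_const_mul_field, deriv_comp_const_add, add_zero]

lemma spDeriv_iterate_tensorFun (n : ℕ) (i : Fin n) (T : ℝ → ℝ) (j : ℕ) (g : Fin n → ℝ → ℝ) :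
    (spDeriv n i)^[j] (tensorFun n T g) =
      tensorFun n T (Function.update g i (iteratedDeriv j (g i))) := by
  induction j generalizing g with
  | zero => simp
  | succ j ih =>
    rw [Function.iterate_succ_apply, spDeriv_tensorFun, ih, iteratedDeriv_succ']
    simp

lemma mDeriv_tensorFun (n : ℕ) (α : Fin n → ℕ) (T : ℝ → ℝ) (g : Fin n → ℝ → ℝ) :
    mDeriv n α (tensorFun n T g) = tensorFun n T fun i => iteratedDeriv (α i) (g i) := by
  have key : ∀ l : List (Fin n), l.Nodup →
      l.foldr (fun i ψ => (spDeriv n i)^[α i] ψ) (tensorFun n T g) =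
        tensorFun n T fun i => if i ∈ l then iteratedDeriv (α i) (g i) else g i := by
    intro l hl
    induction l with
    | nil => simp
    | cons i l ih =>
      obtain ⟨hi, hl⟩ := List.nodup_cons.1 hl
      rw [List.foldr_cons, ih hl, spDeriv_iterate_tensorFun]
      congr 1
      funext j
      by_cases hj : j = i
      · subst hj; simp [hi]
      · simp [hj]
  rw [mDeriv, key _ (List.nodup_finRange n)]
  simp

/-! ### Space-time boxes -/

/-- The cube `[-r, r]ⁿ`. -/
def cube (n : ℕ) (r : ℝ) : Set (Spc n) := {x | ∀ i, |x i| ≤ r}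

/-- The box `[-r, r]ⁿ × (0, r]`. -/
def box (n : ℕ) (r : ℝ) : Set (Spc n × ℝ) := cube n r ×ˢ Ioc 0 r

lemma measurableSet_cube (n : ℕ) (r : ℝ) : MeasurableSet (cube n r) := by
  have : IsClosed (cube n r) := by
    simp only [cube, ofPred_forall]
    exact isClosed_iInter fun i => isClosed_le (by fun_prop) continuous_const
  exact this.measurableSet

lemma measurableSet_box (n : ℕ) (r : ℝ) : MeasurableSet (box n r) :=
  (measurableSet_cube n r).prod measurableSet_Ioc

lemma measurableSet_halfSp (n : ℕ) : MeasurableSet (halfSp n) :=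
  measurableSet_lt measurable_const measurable_snd

lemma box_subset_halfSp (n : ℕ) (r : ℝ) : box n r ⊆ halfSp n := fun _ hz => hz.2.1

lemma box_mono (n : ℕ) {r r' : ℝ} (h : r ≤ r') : box n r ⊆ box n r' := fun _ hz =>
  ⟨fun i => (hz.1 i).trans h, hz.2.1, hz.2.2.trans h⟩

lemma norm_le_of_mem_cube {n : ℕ} {r : ℝ} (hr : 0 ≤ r) {x : Spc n} (hx : x ∈ cube n r) :
    ‖x‖ ≤ (n + 1) * r := by
  rw [EuclideanSpace.norm_eq]
  refine Real.sqrt_le_iff.2 ⟨by positivity, ?_⟩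
  calc ∑ i, ‖x i‖ ^ 2 ≤ ∑ _i : Fin n, r ^ 2 := by
        gcongr with i _
        exact hx i
    _ = n * r ^ 2 := by simp
    _ ≤ ((n + 1) * r) ^ 2 := by
        rw [mul_pow]
        gcongr
        nlinarith [(Nat.cast_nonneg n : (0 : ℝ) ≤ n)]

lemma box_subset_cyl (n : ℕ) {r : ℝ} (hr : 0 ≤ r) : box n r ⊆ cyl n ((n + 1) * r + 1) 1 := by
  rintro z ⟨hz, h0, h1⟩
  have hx := norm_le_of_mem_cube hr hz
  refine ⟨?_, h0, ?_⟩
  · rw [ball0, mem_ball_zero_iff]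
    linarith
  · rw [rpow_one]
    nlinarith [(Nat.cast_nonneg n : (0 : ℝ) ≤ n)]

lemma volume_cube (n : ℕ) (r : ℝ) : volume (cube n r) = ENNReal.ofReal (2 * r) ^ n := by
  have h1 : cube n r = (WithLp.ofLp : Spc n → Fin n → ℝ) ⁻¹'
      (Set.univ.pi fun _ => Icc (-r) r) := by
    ext x
    simp [cube, abs_le, forall_and, Pi.le_def]
  rw [h1, (PiLp.volume_preserving_ofLp (Fin n)).measure_preimage
    (MeasurableSet.univ_pi fun _ => measurableSet_Icc).nullMeasurableSet, volume_pi_pi]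
  simp [two_mul]

lemma volume_real_box (n : ℕ) {r : ℝ} (hr : 0 ≤ r) :
    volume.real (box n r) = (2 * r) ^ n * r := by
  rw [measureReal_def, box, Measure.volume_eq_prod, Measure.prod_prod, volume_cube,
    Real.volume_Ioc, sub_zero, ENNReal.toReal_mul, ENNReal.toReal_pow,
    ENNReal.toReal_ofReal hr, ENNReal.toReal_ofReal (by positivity)]

lemma volume_box_lt_top (n : ℕ) (r : ℝ) : volume (box n r) < ⊤ := by
  rw [box, Measure.volume_eq_prod, Measure.prod_prod, volume_cube, Real.volume_Ioc]
  exact ENNReal.mul_lt_top (ENNReal.pow_lt_top ENNReal.ofReal_lt_top) ENNReal.ofReal_lt_top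

/-! ### The localized energy estimate -/

lemma tensorFun_eq_zero {n : ℕ} {r : ℝ} {T : ℝ → ℝ} {g : Fin n → ℝ → ℝ}
    (hT : ∀ s, r < |s| → T s = 0) (hg : ∀ i s, r < |s| → g i s = 0) {z : Spc n × ℝ}
    (hz : z.1 ∉ cube n r ∨ r < |z.2|) : tensorFun n T g z = 0 := by
  rcases hz with hz | hz
  · obtain ⟨i, hi⟩ := not_forall.1 hz
    rw [tensorFun, Finset.prod_eq_zero (Finset.mem_univ i) (hg i _ (not_le.1 hi)), mul_zero]
  · rw [tensorFun, hT _ hz, zero_mul]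

/-- The cutoff function of the box `box n r` inside `box n (r + h)`. -/
def boxCutoff (n : ℕ) (r h : ℝ) : Spc n × ℝ → ℝ :=
  tensorFun n (cutoff r h) fun _ => cutoff r h

lemma boxCutoff_contDiff (n : ℕ) (r h : ℝ) : ContDiff ℝ (⊤ : ℕ∞) (boxCutoff n r h) := by
  unfold boxCutoff tensorFun
  refine ContDiff.mul ((cutoff_contDiff r h).comp contDiff_snd)
    (contDiff_prod fun i _ => (cutoff_contDiff r h).comp ?_)
  fun_prop

lemma boxCutoff_nonneg {n : ℕ} {r h : ℝ} (hr : 0 < r) (hh : 0 < h) (z : Spc n × ℝ) :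
    0 ≤ boxCutoff n r h z :=
  mul_nonneg (cutoff_nonneg hr hh _) (Finset.prod_nonneg fun _ _ => cutoff_nonneg hr hh _)

lemma boxCutoff_eq_one {n : ℕ} {r h : ℝ} (hh : 0 < h) {z : Spc n × ℝ}
    (hz : z ∈ box n r) : boxCutoff n r h z = 1 := by
  have h1 : cutoff r h z.2 = 1 := cutoff_eq_one hh (by rw [abs_of_pos hz.2.1]; exact hz.2.2)
  rw [boxCutoff, tensorFun, h1, Finset.prod_eq_one fun i _ => cutoff_eq_one hh (hz.1 i), one_mul]

lemma boxCutoff_hasCompactSupport {n : ℕ} {r h : ℝ} (hr : 0 < r) (hh : 0 < h) :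
    HasCompactSupport (boxCutoff n r h) := by
  refine HasCompactSupport.intro (isCompact_closedBall 0 ((n + 1) * (r + h))) fun z hz => ?_
  refine tensorFun_eq_zero (r := r + h) (fun s => cutoff_eq_zero hr hh)
    (fun _ s => cutoff_eq_zero hr hh) ?_
  by_contra! hcon
  refine hz (mem_closedBall_zero_iff.2 (max_le (norm_le_of_mem_cube (by positivity) hcon.1)
    (hcon.2.trans ?_)))
  nlinarith [(Nat.cast_nonneg n : (0 : ℝ) ≤ n)]

lemma tensorFun_iteratedDeriv_eq_zero {n : ℕ} {r h : ℝ} (hr : 0 < r) (hh : 0 < h) (j : ℕ)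
    (α : Fin n → ℕ) {z : Spc n × ℝ} (hz : z ∈ halfSp n) (hz' : z ∉ box n (r + h)) :
    tensorFun n (iteratedDeriv j (cutoff r h)) (fun i => iteratedDeriv (α i) (cutoff r h)) z
      = 0 := by
  refine tensorFun_eq_zero (r := r + h) (fun s hs => iteratedDeriv_cutoff_eq_zero hr hh hs j)
    (fun i s hs => iteratedDeriv_cutoff_eq_zero hr hh hs _) ?_
  by_contra! hcon
  exact hz' ⟨hcon.1, hz, (le_abs_self _).trans hcon.2⟩

lemma exists_bound_tensorFun_iteratedDeriv (n N : ℕ) :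
    ∃ D : ℝ, 1 ≤ D ∧ ∀ r h : ℝ, 0 < r → 0 < h → ∀ j ≤ N, ∀ α : Fin n → ℕ, (∀ i, α i ≤ N) →
      ∀ z, |tensorFun n (iteratedDeriv j (cutoff r h))
        (fun i => iteratedDeriv (α i) (cutoff r h)) z| ≤ D * (h⁻¹) ^ (j + ∑ i, α i) := by
  obtain ⟨D, hD1, hD⟩ := exists_bound_iteratedDeriv_cutoff N
  refine ⟨D * D ^ n, one_le_mul_of_one_le_of_one_le hD1 (one_le_pow₀ hD1),
    fun r h hr hh j hj α hα z => ?_⟩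
  rw [tensorFun, abs_mul, Finset.abs_prod]
  calc _ ≤ (D * (h⁻¹) ^ j) * ∏ i, (D * (h⁻¹) ^ α i) :=
        mul_le_mul (hD r h hr hh j hj _)
          (Finset.prod_le_prod (fun _ _ => abs_nonneg _) fun i _ => hD r h hr hh _ (hα i) _)
          (Finset.prod_nonneg fun _ _ => abs_nonneg _) (by positivity)
    _ = _ := by
        rw [Finset.prod_mul_distrib, Finset.prod_pow_eq_pow_sum, pow_add]
        simp
        ring

lemma tDeriv_iterate_boxCutoff (n j : ℕ) (r h : ℝ) :
    (tDeriv n)^[j] (boxCutoff n r h) = tensorFun n (iteratedDeriv j (cutoff r h))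
      fun i => iteratedDeriv ((0 : Fin n → ℕ) i) (cutoff r h) := by
  rw [boxCutoff, tDeriv_iterate_tensorFun]
  simp

lemma mDeriv_boxCutoff (n : ℕ) (α : Fin n → ℕ) (r h : ℝ) :
    mDeriv n α (boxCutoff n r h) = tensorFun n (iteratedDeriv 0 (cutoff r h))
      fun i => iteratedDeriv (α i) (cutoff r h) := by
  rw [boxCutoff, mDeriv_tensorFun, iteratedDeriv_zero]

lemma abs_setIntegral_halfSp_le {n : ℕ} {r : ℝ} {F G : Spc n × ℝ → ℝ}
    (hG : IntegrableOn G (box n r)) (h0 : ∀ z ∈ halfSp n, z ∉ box n r → F z = 0)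
    (hF : ∀ᵐ z ∂(volume.restrict (halfSp n)), z ∈ box n r → |F z| ≤ G z) :
    |∫ z in halfSp n, F z| ≤ ∫ z in box n r, G z := by
  have hinter : halfSp n ∩ box n r = box n r := inter_eq_right.2 (box_subset_halfSp n r)
  have hint : IntegrableOn ((box n r).indicator G) (halfSp n) :=
    (hG.integrable_indicator (measurableSet_box n r)).integrableOn
  rw [← Real.norm_eq_abs]
  refine (norm_integral_le_of_norm_le hint ?_).trans_eq ?_
  · filter_upwards [hF, ae_restrict_mem (measurableSet_halfSp n)] with z hz hzh
    by_cases hzb : z ∈ box n r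
    · rw [indicator_of_mem hzb]
      exact hz hzb
    · rw [indicator_of_notMem hzb, h0 z hzh hzb, norm_zero]
  · rw [setIntegral_indicator (measurableSet_box n r), hinter]

lemma energy_estimate {n k m : ℕ} (hk : 1 ≤ k) {A p : ℝ} (hA : 0 < A)
    {a : (Fin n → ℕ) → Spc n × ℝ → ℝ → ℝ} (ha : GoodCoeffs n m A p a)
    {f : ℝ → ℝ} (hf : ∀ ζ, 0 ≤ ζ → 0 ≤ f ζ) {u0 : ℕ → Spc n → ℝ}
    (hu0nn : ∀ᵐ x ∂(volume : Measure (Spc n)), 0 ≤ u0 (k - 1) x)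
    {u : Spc n × ℝ → ℝ} (hu : IsGlobalWeakSol n k m p a f u0 u) :
    ∃ C : ℝ, 0 < C ∧ ∀ r h : ℝ, 0 < r → 0 < h →
      ∫ z in box n r, f |u z| ≤ C * ((h⁻¹) ^ k * ∫ z in box n (r + h), |u z|) +
        C * ((h⁻¹) ^ m * ∫ z in box n (r + h), |u z| ^ p) := by
  obtain ⟨hu1, hup, huf, hsol⟩ := hu
  obtain ⟨D, hD1, hD⟩ := exists_bound_tensorFun_iteratedDeriv n (max k m)
  have hD0 : 0 < D := by linarith
  set c : ℝ := ((mIdx n m).card : ℝ)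
  refine ⟨D * (1 + c * A), by positivity, fun r h hr hh => ?_⟩
  have hrh : 0 ≤ r + h := by positivity
  have hrad : (0 : ℝ) < (n + 1) * (r + h) + 1 := by positivity
  have hsub := box_subset_cyl n hrh
  have hsmall : box n r ⊆ box n (r + h) := box_mono n (by linarith)
  have hint1 : IntegrableOn (fun z => |u z|) (box n (r + h)) :=
    ((hu1 _ hrad).mono_set hsub).abs
  have hintp : IntegrableOn (fun z => |u z| ^ p) (box n (r + h)) := (hup _ hrad).mono_set hsub
  have hintf : IntegrableOn (fun z => f |u z|) (box n (r + h)) := (huf _ hrad).mono_set hsub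
  set φ := boxCutoff n r h with hφ
  have hmain := hsol φ (boxCutoff_contDiff n r h) (boxCutoff_hasCompactSupport hr hh)
    (boxCutoff_nonneg hr hh)
  have htime : |∫ z in halfSp n, (-1 : ℝ) ^ k * u z * (tDeriv n)^[k] φ z| ≤
      ∫ z in box n (r + h), D * (h⁻¹) ^ k * |u z| := by
    refine abs_setIntegral_halfSp_le (hint1.const_mul _) (fun z hz hz' => ?_)
      (Eventually.of_forall fun z _ => ?_)
    · rw [hφ, tDeriv_iterate_boxCutoff, tensorFun_iteratedDeriv_eq_zero hr hh k _ hz hz', mul_zero]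
    · rw [abs_mul, abs_mul, abs_pow, abs_neg, abs_one, one_pow, one_mul, mul_comm, hφ,
        tDeriv_iterate_boxCutoff]
      gcongr
      simpa using hD r h hr hh k (le_max_left _ _) 0 (fun _ => Nat.zero_le _) z
  have hspace : |∫ z in halfSp n, ∑ α ∈ mIdx n m,
      (-1 : ℝ) ^ m * a α z (u z) * mDeriv n α φ z| ≤
      ∫ z in box n (r + h), c * (A * (D * (h⁻¹) ^ m)) * |u z| ^ p := by
    refine abs_setIntegral_halfSp_le (hintp.const_mul _) (fun z hz hz' => ?_) ?_
    · refine Finset.sum_eq_zero fun α _ => ?_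
      rw [hφ, mDeriv_boxCutoff, tensorFun_iteratedDeriv_eq_zero hr hh 0 _ hz hz', mul_zero]
    · have hae : ∀ᵐ z ∂(volume.restrict (halfSp n)), ∀ α ∈ mIdx n m, ∀ ζ : ℝ,
          |a α z ζ| ≤ A * |ζ| ^ p :=
        (Finset.eventually_all _).2 fun α hα => (ha α hα).2.2
      filter_upwards [hae] with z hz _
      refine (Finset.abs_sum_le_sum_abs _ _).trans ((Finset.sum_le_card_nsmul _ _
        (A * |u z| ^ p * (D * (h⁻¹) ^ m)) fun α hα => ?_).trans_eq ?_)
      · obtain ⟨hα1, hα2⟩ := Finset.mem_filter.1 hα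
        rw [abs_mul, abs_mul, abs_pow, abs_neg, abs_one, one_pow, one_mul, hφ, mDeriv_boxCutoff]
        gcongr
        · exact hz α hα _
        · have := hD r h hr hh 0 (Nat.zero_le _) α (fun i => ?_) z
          · rwa [zero_add, hα2] at this
          · exact (Nat.lt_succ_iff.1 (Finset.mem_range.1 (Fintype.mem_piFinset.1 hα1 i))).trans
              (le_max_right _ _)
      · rw [nsmul_eq_mul]
        ring
  have hinit : 0 ≤ ∫ x : Spc n, ∑ i ∈ Finset.range k,
      (-1 : ℝ) ^ i * u0 (k - 1 - i) x * (tDeriv n)^[i] φ (x, 0) := by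
    refine integral_nonneg_of_ae ?_
    filter_upwards [hu0nn] with x hx
    rw [Finset.sum_eq_single_of_mem 0 (Finset.mem_range.2 hk) fun i _ hi => ?_]
    · simpa using mul_nonneg hx (boxCutoff_nonneg hr hh (x, 0))
    · rw [hφ, tDeriv_iterate_boxCutoff, tensorFun, iteratedDeriv_cutoff_zero hr hh hi, zero_mul,
        mul_zero]
  have hsource : ∫ z in box n r, f |u z| ≤ ∫ z in halfSp n, f |u z| * φ z := by
    have hφb : ∀ z, |φ z| ≤ D := fun z => by
      simpa [hφ, boxCutoff] using hD r h hr hh 0 (Nat.zero_le _) 0 (fun _ => Nat.zero_le _) z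
    have hφ0 : ∀ z ∈ halfSp n, z ∉ box n (r + h) → φ z = 0 := fun z hz hz' => by
      simpa [hφ, boxCutoff] using
        tensorFun_iteratedDeriv_eq_zero hr hh 0 (0 : Fin n → ℕ) hz hz'
    have hi : IntegrableOn (fun z => f |u z| * φ z) (halfSp n) := by
      refine IntegrableOn.of_forall_sdiff_eq_zero (s := box n (r + h)) ?_
        (measurableSet_halfSp n) fun z hz => ?_
      · exact hintf.mul_bdd (c := D)
          (boxCutoff_contDiff n r h).continuous.aestronglyMeasurable
          (Eventually.of_forall hφb)
      · rw [hφ0 z hz.1 hz.2, mul_zero]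
    calc ∫ z in box n r, f |u z| = ∫ z in box n r, f |u z| * φ z :=
          setIntegral_congr_fun (measurableSet_box n r) fun z hz => by
            simp [hφ, boxCutoff_eq_one hh hz]
      _ ≤ _ := setIntegral_mono_set hi
          (Eventually.of_forall fun z => mul_nonneg (hf _ (abs_nonneg _))
            (boxCutoff_nonneg hr hh z)) (box_subset_halfSp n r).eventuallyLE
  rw [integral_const_mul] at htime hspace
  have h1 : 0 ≤ (h⁻¹) ^ k * ∫ z in box n (r + h), |u z| :=
    mul_nonneg (by positivity) (integral_nonneg fun _ => abs_nonneg _)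
  have h2 : 0 ≤ (h⁻¹) ^ m * ∫ z in box n (r + h), |u z| ^ p :=
    mul_nonneg (by positivity) (integral_nonneg fun _ => rpow_nonneg (abs_nonneg _) _)
  have h3 : 0 ≤ D * (c * A) * ((h⁻¹) ^ k * ∫ z in box n (r + h), |u z|) := by positivity
  have h4 : 0 ≤ D * ((h⁻¹) ^ m * ∫ z in box n (r + h), |u z| ^ p) := by positivity
  have h5 := (abs_le.1 hspace).1
  have h6 := (abs_le.1 htime).2
  linarith

/-! ### Convexity -/

lemma ConvexOn.exists_supporting_line_Ici {f : ℝ → ℝ} (hmono : MonotoneOn f (Ici 0))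
    (hconv : ConvexOn ℝ (Ici 0) f) {l : ℝ} (hl : 0 ≤ l) :
    ∃ c : ℝ, 0 ≤ c ∧ ∀ x, 0 ≤ x → f l + c * (x - l) ≤ f x := by
  rcases hl.eq_or_lt with rfl | hl0
  · exact ⟨0, le_rfl, fun x hx => by simpa using hmono self_mem_Ici hx hx⟩
  have hint : l ∈ interior (Ici (0 : ℝ)) := by simpa using hl0
  have hlr := hconv.leftDeriv_le_rightDeriv_of_mem_interior hint
  refine ⟨derivWithin f (Ioi l) l, ?_, fun x hx => ?_⟩
  · have h1 := hconv.slope_le_leftDeriv_of_mem_interior self_mem_Ici hint hl0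
    refine le_trans ?_ (h1.trans hlr)
    rw [slope_def_field]
    exact div_nonneg (sub_nonneg.2 (hmono self_mem_Ici hl hl)) (by linarith)
  · rcases lt_trichotomy x l with hxl | rfl | hxl
    · have h1 := (hconv.slope_le_leftDeriv_of_mem_interior hx hint hxl).trans hlr
      rw [slope_def_field, div_le_iff₀ (by linarith)] at h1
      linarith
    · simp
    · have h1 := hconv.rightDeriv_le_slope_of_mem_interior hint hx hxl
      rw [slope_def_field, le_div_iff₀ (by linarith)] at h1
      linarith

lemma ConvexOn.mul_measure_le_setIntegral {X : Type*} [MeasurableSpace X] {ν : Measure X}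
    {f : ℝ → ℝ} (hmono : MonotoneOn f (Ici 0)) (hconv : ConvexOn ℝ (Ici 0) f) {s : Set X}
    (hs : ν s ≠ ⊤) {g : X → ℝ} (hg0 : ∀ x, 0 ≤ g x) (hg : IntegrableOn g s ν)
    (hfg : IntegrableOn (fun x => f (g x)) s ν) {l : ℝ} (hl : 0 ≤ l)
    (hlg : l * ν.real s ≤ ∫ x in s, g x ∂ν) :
    f l * ν.real s ≤ ∫ x in s, f (g x) ∂ν := by
  obtain ⟨c, hc, hline⟩ := ConvexOn.exists_supporting_line_Ici hmono hconv hl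
  have hconst : ∀ b : ℝ, IntegrableOn (fun _ => b) s ν := fun b =>
    integrableOn_const (hs := hs)
  have hlin : IntegrableOn (fun x => c * (g x - l)) s ν := (hg.sub (hconst l)).const_mul c
  have h1 : ∫ x in s, (f l + c * (g x - l)) ∂ν ≤ ∫ x in s, f (g x) ∂ν :=
    integral_mono ((hconst _).add hlin) hfg
      fun x => hline _ (hg0 x)
  rw [integral_add (hconst _) hlin, integral_const_mul,
    integral_sub hg (hconst _), setIntegral_const, setIntegral_const, smul_eq_mul,
    smul_eq_mul] at h1
  have h2 : 0 ≤ c * ((∫ x in s, g x ∂ν) - ν.real s * l) := mul_nonneg hc (by linarith)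
  linarith

lemma rpow_le_const_mul_add {p l x : ℝ} (hp0 : 0 ≤ p) (hp1 : p ≤ 1) (hl : 0 < l) (hx : 0 ≤ x) :
    x ^ p ≤ l ^ p + l ^ p / l * x := by
  rcases le_total x l with h | h
  · have := rpow_le_rpow hx h hp0
    have : 0 ≤ l ^ p / l * x := by positivity
    linarith
  · have h1 : (x / l) ^ p ≤ (x / l) ^ (1 : ℝ) :=
      rpow_le_rpow_of_exponent_le ((one_le_div hl).2 h) hp1
    rw [rpow_one, div_rpow hx hl.le, div_le_div_iff₀ (by positivity) hl] at h1
    have h2 : x ^ p ≤ l ^ p / l * x := by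
      rw [div_mul_eq_mul_div, le_div_iff₀ hl]
      linarith
    have : 0 ≤ l ^ p := by positivity
    linarith

lemma setIntegral_rpow_le {X : Type*} [MeasurableSpace X] {ν : Measure X} {s : Set X}
    (hs : ν s ≠ ⊤) {g : X → ℝ} (hg0 : ∀ x, 0 ≤ g x) (hg : IntegrableOn g s ν) {p l : ℝ}
    (hgp : IntegrableOn (fun x => g x ^ p) s ν) (hp0 : 0 ≤ p) (hp1 : p ≤ 1) (hl : 0 < l) :
    ∫ x in s, g x ^ p ∂ν ≤ l ^ p * ν.real s + l ^ p / l * ∫ x in s, g x ∂ν := by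
  have hconst : IntegrableOn (fun _ => l ^ p) s ν := integrableOn_const (hs := hs)
  refine (integral_mono hgp (hconst.add (hg.const_mul _)) fun x =>
    rpow_le_const_mul_add hp0 hp1 hl (hg0 x)).trans_eq ?_
  simp only [Pi.add_apply]
  rw [integral_add hconst (hg.const_mul _), integral_const_mul, setIntegral_const, smul_eq_mul,
    mul_comm]

/-! ### Dyadic summability -/

lemma summable_dyadic_of_integrableOn {f : ℝ → ℝ} (hmono : MonotoneOn f (Ici 0))
    (hpos : ∀ ζ, 0 < ζ → 0 < f ζ) {s q : ℝ} (hs : 0 ≤ s) (hq : 0 ≤ q)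
    (hint : IntegrableOn (fun ζ : ℝ => ζ ^ (s - 1) / f ζ ^ q) (Ioi 1)) :
    Summable fun i : ℕ => ((2 : ℝ) ^ i) ^ s / f (2 ^ i) ^ q := by
  have hpow : Monotone fun i : ℕ => (2 : ℝ) ^ i := pow_right_mono₀ one_le_two
  have hsub : (⋃ i : ℕ, Ioc ((2 : ℝ) ^ i) (2 ^ (i + 1))) ⊆ Ioi 1 :=
    iUnion_subset fun i x hx => (one_le_pow₀ one_le_two).trans_lt hx.1
  have hsum := (hasSum_integral_iUnion (fun i => measurableSet_Ioc)
    hpow.pairwise_disjoint_on_Ioc_succ (hint.mono_set hsub)).summable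
  have hle : ∀ i : ℕ, ((2 : ℝ) ^ (i + 1)) ^ s / f (2 ^ (i + 1)) ^ q ≤
      2 * 2 ^ s * ∫ ζ in Ioc ((2 : ℝ) ^ i) (2 ^ (i + 1)), ζ ^ (s - 1) / f ζ ^ q := fun i => by
    set b : ℝ := 2 ^ i with hb
    have hb0 : 0 < b := by positivity
    have hb2 : (2 : ℝ) ^ (i + 1) = 2 * b := by rw [pow_succ, mul_comm]
    rw [hb2]
    have hf2 : 0 < f (2 * b) := hpos _ (by positivity)
    have hptw : ∀ ζ ∈ Ioc b (2 * b), b ^ s / (2 * b) / f (2 * b) ^ q ≤ ζ ^ (s - 1) / f ζ ^ q := by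
      intro ζ hζ
      have hζ0 : 0 < ζ := hb0.trans hζ.1
      have hfζ := hpos ζ hζ0
      rw [rpow_sub_one hζ0.ne']
      have := hmono (mem_Ici.2 hζ0.le) (mem_Ici.2 (by positivity : 0 ≤ 2 * b)) hζ.2
      gcongr
      · exact hζ.1.le
      · exact hζ.2
    have hconst : IntegrableOn (fun _ : ℝ => b ^ s / (2 * b) / f (2 * b) ^ q) (Ioc b (2 * b)) :=
      integrableOn_const (hs := by simp)
    have hi := setIntegral_mono_on hconst
      (hint.mono_set fun x hx => (one_le_pow₀ one_le_two).trans_lt hx.1) measurableSet_Ioc hptw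
    rw [setIntegral_const, measureReal_def, Real.volume_Ioc, ENNReal.toReal_ofReal (by linarith),
      smul_eq_mul] at hi
    refine le_trans (le_of_eq ?_) (mul_le_mul_of_nonneg_left hi (by positivity))
    rw [mul_rpow zero_le_two hb0.le]
    have : f (2 * b) ^ q ≠ 0 := (rpow_pos_of_pos hf2 q).ne'
    field_simp
    ring
  refine (summable_nat_add_iff 1).1 (Summable.of_nonneg_of_le (fun i => ?_) hle
    (hsum.mul_left _))
  have := hpos (2 ^ (i + 1)) (by positivity)
  positivity

/-! ### Nonexistence of solutions -/

lemma pos_at_zero_of_tendsto {f : ℝ → ℝ} (hconv : ConvexOn ℝ (Ici 0) f)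
    (hpos : ∀ ζ, 0 < ζ → 0 < f ζ) {μ : ℝ} (hμ : μ ≤ 1)
    (hlim : Tendsto (fun r : ℝ => f r / r ^ μ) (nhdsWithin 0 (Ioi 0)) atTop) : 0 < f 0 := by
  by_contra! h0
  have hev := (hlim.eventually_gt_atTop (f 1)).and (Ioo_mem_nhdsGT (zero_lt_one' ℝ))
  obtain ⟨r, hr, hr0, hr1⟩ := hev.exists
  have h1 := hconv.2 (self_mem_Ici : (0 : ℝ) ∈ Ici 0) (mem_Ici.2 zero_le_one : (1 : ℝ) ∈ Ici 0)
    (by linarith : 0 ≤ 1 - r) hr0.le (by ring)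
  simp only [smul_eq_mul, mul_zero, mul_one, zero_add] at h1
  have h2 : f r ≤ r * f 1 := by nlinarith
  have h3 : r ≤ r ^ μ := by simpa using rpow_le_rpow_of_exponent_ge hr0 hr1.le hμ
  rw [lt_div_iff₀ (rpow_pos_of_pos hr0 μ)] at hr
  nlinarith [hpos 1 one_pos]

lemma not_isGlobalWeakSol {n k m : ℕ} (hk : 1 ≤ k) (hm : 1 ≤ m) {A p : ℝ} (hA : 0 < A)
    (hp : 0 < p) (hp1 : p ≤ 1) {a : (Fin n → ℕ) → Spc n × ℝ → ℝ → ℝ}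
    (ha : GoodCoeffs n m A p a) {f : ℝ → ℝ} (hmono : MonotoneOn f (Ici 0))
    (hconv : ConvexOn ℝ (Ici 0) f) (hf0 : 0 < f 0) {u0 : ℕ → Spc n → ℝ}
    (hu0nn : ∀ᵐ x ∂(volume : Measure (Spc n)), 0 ≤ u0 (k - 1) x)
    (h14 : Cond14 k f) (h15 : Cond15 m p f) (u : Spc n × ℝ → ℝ) :
    ¬ IsGlobalWeakSol n k m p a f u0 u := by
  intro hu
  have hpos : ∀ ζ, 0 ≤ ζ → 0 < f ζ := fun ζ hζ => hf0.trans_le (hmono self_mem_Ici hζ hζ)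
  have hk0 : k ≠ 0 := by omega
  have hm0 : m ≠ 0 := by omega
  obtain ⟨C, hC, hen⟩ := energy_estimate hk hA ha (fun ζ hζ => (hpos ζ hζ).le) hu0nn hu
  obtain ⟨hu1, hup, huf, -⟩ := hu
  have hrad : ∀ r : ℝ, 0 ≤ r → 0 < (n + 1) * r + 1 := fun r hr => by positivity
  have hint1 : ∀ r : ℝ, 0 ≤ r → IntegrableOn (fun z => |u z|) (box n r) := fun r hr =>
    ((hu1 _ (hrad r hr)).mono_set (box_subset_cyl n hr)).abs
  have hintp : ∀ r : ℝ, 0 ≤ r → IntegrableOn (fun z => |u z| ^ p) (box n r) := fun r hr =>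
    (hup _ (hrad r hr)).mono_set (box_subset_cyl n hr)
  have hintf : ∀ r : ℝ, 0 ≤ r → IntegrableOn (fun z => f |u z|) (box n r) := fun r hr =>
    (huf _ (hrad r hr)).mono_set (box_subset_cyl n hr)
  set M : ℝ := 2 * 2 ^ (n + 1) * C with hM
  have hM0 : 0 < M := by positivity
  have hgrow : ∀ R r h l L : ℝ, 0 < R → R ≤ r → 0 < h → r + h ≤ 2 * R → 0 ≤ l → 0 < L →
      M * ((h⁻¹) ^ k * L) + M * ((h⁻¹) ^ m * L ^ p) < f l →
      l * volume.real (box n (2 * R)) ≤ ∫ z in box n r, |u z| →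
      L * volume.real (box n (2 * R)) ≤ ∫ z in box n (r + h), |u z| := by
    intro R r h l L hR hRr hh hrh hl hL hsmall hlower
    by_contra! hcon
    have hr : 0 < r := hR.trans_le hRr
    have hvol : ∀ r₁ r₂ : ℝ, r₁ ≤ r₂ → volume.real (box n r₁) ≤ volume.real (box n r₂) :=
      fun r₁ r₂ h12 => measureReal_mono (box_mono n h12) (volume_box_lt_top n r₂).ne
    have hV : volume.real (box n (2 * R)) = 2 ^ (n + 1) * volume.real (box n R) := by
      rw [volume_real_box n (by positivity), volume_real_box n hR.le, mul_pow 2 (2 * R)]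
      ring
    have hV0 : 0 < volume.real (box n R) := by
      rw [volume_real_box n hR.le]
      positivity
    set V := volume.real (box n (2 * R))
    have hVp : 0 < V := by rw [hV]; positivity
    have h1 : f l * volume.real (box n R) ≤ ∫ z in box n r, f |u z| := by
      refine le_trans ?_ (ConvexOn.mul_measure_le_setIntegral hmono hconv
        (volume_box_lt_top n r).ne (fun z => abs_nonneg (u z)) (hint1 r hr.le) (hintf r hr.le) hl
        (le_trans ?_ hlower))
      · exact mul_le_mul_of_nonneg_left (hvol _ _ hRr) (hpos l hl).le
      · exact mul_le_mul_of_nonneg_left (hvol _ _ (by linarith)) hl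
    have h2 : ∫ z in box n (r + h), |u z| ^ p ≤ 2 * L ^ p * V := by
      have hLp : 0 < L ^ p := rpow_pos_of_pos hL p
      calc _ ≤ L ^ p * volume.real (box n (r + h)) +
              L ^ p / L * ∫ z in box n (r + h), |u z| :=
            setIntegral_rpow_le (volume_box_lt_top n _).ne (fun z => abs_nonneg (u z))
              (hint1 _ (by positivity)) (hintp _ (by positivity)) hp.le hp1 hL
        _ ≤ L ^ p * V + L ^ p / L * (L * V) := by
            gcongr
            exact hvol _ _ hrh
        _ = 2 * L ^ p * V := by
            field_simp
            ring
    have h3 : f l * volume.real (box n R) ≤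
        C * ((h⁻¹) ^ k * (L * V)) + C * ((h⁻¹) ^ m * (2 * L ^ p * V)) := by
      refine (h1.trans (hen r h hr hh)).trans ?_
      gcongr
    have h4 : 0 ≤ C * ((h⁻¹) ^ k * (L * V)) := by positivity
    have h5 : f l * volume.real (box n R) ≤
        (M * ((h⁻¹) ^ k * L) + M * ((h⁻¹) ^ m * L ^ p)) * volume.real (box n R) := by
      calc _ ≤ 2 * (C * ((h⁻¹) ^ k * (L * V))) + C * ((h⁻¹) ^ m * (2 * L ^ p * V)) := by
            linarith
        _ = _ := by
            rw [hV, hM]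
            ring
    exact absurd (le_of_mul_le_mul_right h5 hV0) (not_le.2 hsmall)
  have hstep : ∀ {c x : ℝ} {j : ℕ}, j ≠ 0 → 0 < c → 0 < x →
      ∀ h, (4 * M * (x / c)) ^ ((j : ℝ)⁻¹) ≤ h → 0 < h ∧ M * ((h⁻¹) ^ j * x) ≤ c / 4 := by
    intro c x j hj hc hx h hle
    have hbase : 0 < 4 * M * (x / c) := by positivity
    have hh : 0 < h := (rpow_pos_of_pos hbase _).trans_le hle
    refine ⟨hh, ?_⟩
    have h1 : 4 * M * (x / c) ≤ h ^ j := by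
      calc 4 * M * (x / c) = ((4 * M * (x / c)) ^ ((j : ℝ)⁻¹)) ^ j :=
            (rpow_inv_natCast_pow hbase.le hj).symm
        _ ≤ h ^ j := by gcongr
    rw [← mul_div_assoc, div_le_iff₀ hc] at h1
    rw [inv_pow, inv_mul_eq_div, ← mul_div_assoc, div_le_iff₀ (by positivity)]
    linarith
  set d : ℕ → ℝ := fun i => (4 * M * (2 ^ (i + 1) / f (2 ^ i))) ^ ((k : ℝ)⁻¹) +
    (4 * M * (((2 : ℝ) ^ (i + 1)) ^ p / f (2 ^ i))) ^ ((m : ℝ)⁻¹) with hd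
  set d₀ : ℝ := (4 * M * (1 / f 0)) ^ ((k : ℝ)⁻¹) +
    (4 * M * (1 / f 0)) ^ ((m : ℝ)⁻¹) with hd₀
  have hfi : ∀ i : ℕ, 0 < f (2 ^ i) := fun i => hpos _ (by positivity)
  have hdpos : ∀ i, 0 < d i := fun i => by
    have := hfi i
    positivity
  have hd₀pos : 0 < d₀ := by positivity
  have hdsum : Summable d := by
    have hk' := summable_dyadic_of_integrableOn hmono (fun ζ hζ => hpos ζ hζ.le)
      (s := (k : ℝ)⁻¹) (by positivity) (by positivity) h14
    have hm' := summable_dyadic_of_integrableOn hmono (fun ζ hζ => hpos ζ hζ.le)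
      (s := p / m) (by positivity) (by positivity) h15
    refine ((hk'.mul_left ((4 * M * 2) ^ ((k : ℝ)⁻¹))).add
      (hm'.mul_left ((4 * M * 2 ^ p) ^ ((m : ℝ)⁻¹)))).congr fun i => ?_
    have hf' := (hfi i).le
    have hsplit : ((2 : ℝ) ^ (i + 1)) ^ p = 2 ^ p * (2 ^ i) ^ p := by
      rw [pow_succ', mul_rpow zero_le_two (by positivity)]
    simp only [hd]
    rw [hsplit, pow_succ',
      show 4 * M * (2 * 2 ^ i / f (2 ^ i)) = 4 * M * 2 * (2 ^ i / f (2 ^ i)) by ring,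
      show 4 * M * (2 ^ p * ((2 : ℝ) ^ i) ^ p / f (2 ^ i)) =
        4 * M * 2 ^ p * (((2 : ℝ) ^ i) ^ p / f (2 ^ i)) by ring,
      mul_rpow (x := 4 * M * 2) (by positivity) (by positivity),
      mul_rpow (x := 4 * M * 2 ^ p) (by positivity) (by positivity), div_rpow (by positivity) hf', div_rpow (by positivity) hf',
      ← rpow_mul (by positivity) p, ← div_eq_mul_inv]
  have hdtsum : 0 ≤ ∑' i, d i := tsum_nonneg fun i => (hdpos i).le
  set R : ℝ := d₀ + ∑' i, d i with hR
  have hRpos : 0 < R := by positivity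
  have hpartial : ∀ N : ℕ, R + d₀ + ∑ i ∈ Finset.range N, d i ≤ 2 * R := fun N => by
    have := hdsum.sum_le_tsum (Finset.range N) fun i _ => (hdpos i).le
    linarith
  have hRle : ∀ N : ℕ, R ≤ R + d₀ + ∑ i ∈ Finset.range N, d i := fun N => by
    have := Finset.sum_nonneg fun i (_ : i ∈ Finset.range N) => (hdpos i).le
    linarith
  set V := volume.real (box n (2 * R)) with hV
  have hVpos : 0 < V := by
    rw [hV, volume_real_box n (by positivity)]
    positivity
  have hlower : ∀ N : ℕ,
      2 ^ N * V ≤ ∫ z in box n (R + d₀ + ∑ i ∈ Finset.range N, d i), |u z| := by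
    intro N
    induction N with
    | zero =>
      rw [Finset.sum_range_zero, add_zero, pow_zero]
      refine hgrow R R d₀ 0 1 hRpos le_rfl hd₀pos (by simpa using hpartial 0) le_rfl one_pos ?_ ?_
      · have h1 := hstep hk0 hf0 one_pos d₀ (le_add_of_nonneg_right (by positivity))
        have h2 := hstep hm0 hf0 one_pos d₀ (le_add_of_nonneg_left (by positivity))
        rw [one_rpow]
        linarith [h1.2, h2.2]
      · rw [zero_mul]
        exact integral_nonneg fun _ => abs_nonneg _
    | succ N ih =>
      rw [Finset.sum_range_succ, ← add_assoc]
      refine hgrow R _ (d N) (2 ^ N) (2 ^ (N + 1)) hRpos (hRle N) (hdpos N) ?_ (by positivity)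
        (by positivity) ?_ ih
      · have := hpartial (N + 1)
        rwa [Finset.sum_range_succ, ← add_assoc] at this
      · have hf' := hfi N
        have h1 := hstep hk0 hf' (x := 2 ^ (N + 1)) (by positivity) (d N)
          (le_add_of_nonneg_right (by positivity))
        have h2 := hstep hm0 hf' (x := ((2 : ℝ) ^ (N + 1)) ^ p) (by positivity) (d N)
          (le_add_of_nonneg_left (by positivity))
        linarith [h1.2, h2.2]
  have hbdd : ∀ N : ℕ, (2 : ℝ) ^ N ≤ (∫ z in box n (2 * R), |u z|) / V := fun N => by
    rw [le_div_iff₀ hVpos]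
    exact (hlower N).trans (setIntegral_mono_set (hint1 _ (by positivity))
      (Eventually.of_forall fun _ => abs_nonneg _) (box_mono n (hpartial N)).eventuallyLE)
  obtain ⟨N, hN⟩ := pow_unbounded_of_one_lt ((∫ z in box n (2 * R), |u z|) / V) one_lt_two
  exact absurd (hbdd N) (not_le.2 hN)

/-- **Theorem 2.2.** If `n > m (1 - 1/k)`, `0 < p ≤ 1 - m/n`, conditions (1.4), (1.5)
hold, and `lim_{r → 0+} f(r)/r^μ = ∞` for some `μ < p/(1 - m/n)`, then any global
weak solution of problem (1.1i), (1.1c) is trivial. -/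
theorem blowup_small_p
    (n k m : ℕ) (hn : 1 ≤ n) (hk : 1 ≤ k) (hm : 1 ≤ m)
    (A p : ℝ) (hA : 0 < A) (hp : 0 < p)
    (a : (Fin n → ℕ) → Spc n × ℝ → ℝ → ℝ) (ha : GoodCoeffs n m A p a)
    (f : ℝ → ℝ) (hf : GoodF p f)
    (u0 : ℕ → Spc n → ℝ) (hu0 : ∀ i < k, L1locInit n (u0 i))
    (hu0nn : ∀ᵐ x ∂(volume : Measure (Spc n)), 0 ≤ u0 (k - 1) x)
    (h14 : Cond14 k f) (h15 : Cond15 m p f)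
    (hdim : (m : ℝ) * (1 - 1 / (k : ℝ)) < n)
    (hp' : p ≤ 1 - (m : ℝ) / (n : ℝ))
    (μ : ℝ) (hμ : μ < p / (1 - (m : ℝ) / (n : ℝ)))
    (hlim : Tendsto (fun r : ℝ => f r / r ^ μ) (nhdsWithin 0 (Ioi 0)) atTop)
    (u : Spc n × ℝ → ℝ) (hu : IsGlobalWeakSol n k m p a f u0 u) :
    TrivialSol n u := by
  obtain ⟨hmono, hconv, -, -, hpos⟩ := hf
  have hq : 0 < 1 - (m : ℝ) / n := hp.trans_le hp'
  have hμ1 : μ ≤ 1 := hμ.le.trans ((div_le_one hq).2 hp')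
  have hp1 : p ≤ 1 := hp'.trans (sub_le_self _ (by positivity))
  exact absurd hu (not_isGlobalWeakSol hk hm hA hp hp1 ha hmono hconv
    (pos_at_zero_of_tendsto hconv hpos hμ1 hlim) hu0nn h14 h15 u)
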